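/- Let s ∈ (0,1) and let n be an integer with n > 4s. Then there exists a constant α_{n,s} > 0 such that for all x ∈ ℝⁿ, (−Δ)^s [ (1+|·|²)^{(4s−n)/2} ](x) ≥ α_{n,s} (1+|x|²)^{(2s−n)/2}. -/

import Mathlib

open MeasureTheory

noncomputable section

abbrev Euc (n : ℕ) := EuclideanSpace ℝ (Fin n)

/-- Normalization constant of the fractional Laplacian `(-Δ)^s` on `ℝⁿ`. -/
noncomputable def fracC (n : ℕ) (s : ℝ) : ℝ :=
  2 ^ (2 * s) * Real.Gamma (((n : ℝ) + 2 * s) / 2) /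
    (Real.pi ^ ((n : ℝ) / 2) * |Real.Gamma (-s)|)

/-- The fractional Laplacian `(-Δ)^s u` of order `s`, as a symmetrized singular integral. -/
noncomputable def fracLap (n : ℕ) (s : ℝ) (u : Euc n → ℝ) (x : Euc n) : ℝ :=
  (fracC n s / 2) *
    ∫ y : Euc n, (2 * u x - u (x + y) - u (x - y)) / ‖y‖ ^ ((n : ℝ) + 2 * s)

/-- The homogeneous `Ḣˢ` inner product (Gagliardo form). -/
noncomputable def hsInner (n : ℕ) (s : ℝ) (u v : Euc n → ℝ) : ℝ :=
  (fracC n s / 2) *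
    ∫ x : Euc n, ∫ y : Euc n,
      (u x - u y) * (v x - v y) / ‖x - y‖ ^ ((n : ℝ) + 2 * s)

noncomputable def hsNormSq (n : ℕ) (s : ℝ) (u : Euc n → ℝ) : ℝ := hsInner n s u u

noncomputable def hsNorm (n : ℕ) (s : ℝ) (u : Euc n → ℝ) : ℝ := Real.sqrt (hsNormSq n s u)

/-- Membership in the homogeneous Sobolev space `Ḣˢ(ℝⁿ)`. -/
def MemHs (n : ℕ) (s : ℝ) (u : Euc n → ℝ) : Prop :=
  Measurable u ∧
    Integrable (fun q : Euc n × Euc n =>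
      (u q.1 - u q.2) ^ 2 / ‖q.1 - q.2‖ ^ ((n : ℝ) + 2 * s))

/-- The `H^{-s}` (dual) norm of `f`. -/
noncomputable def negSobNorm (n : ℕ) (s : ℝ) (f : Euc n → ℝ) : ℝ :=
  sSup {r : ℝ | ∃ φ : Euc n → ℝ, MemHs n s φ ∧ hsNorm n s φ ≤ 1 ∧ r = ∫ x, f x * φ x}

/-- The critical exponent `p = 2^* - 1 = (n+2s)/(n-2s)`. -/
noncomputable def pexp (n : ℕ) (s : ℝ) : ℝ := ((n : ℝ) + 2 * s) / ((n : ℝ) - 2 * s)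

/-- A Talenti bubble `U[z,λ]`. -/
noncomputable def bubble (n : ℕ) (cns : ℝ) (s : ℝ) (z : Euc n) (lam : ℝ) (x : Euc n) : ℝ :=
  cns * (lam / (1 + lam ^ 2 * ‖x - z‖ ^ 2)) ^ (((n : ℝ) - 2 * s) / 2)

/-- `∂U[z,λ]/∂λ`. -/
noncomputable def dLamBubble (n : ℕ) (cns s : ℝ) (z : Euc n) (lam : ℝ) : Euc n → ℝ :=
  fun x => deriv (fun l : ℝ => bubble n cns s z l x) lam

/-- `∂U[z,λ]/∂z_j`. -/
noncomputable def dZBubble (n : ℕ) (cns s : ℝ) (z : Euc n) (lam : ℝ) (j : Fin n) : Euc n → ℝ :=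
  fun x => deriv (fun t : ℝ => bubble n cns s (z + t • EuclideanSpace.single j (1 : ℝ)) lam x) 0

/-- The rescaled derivatives `Z_i^a` (`a = 1,…,n` translations, `a = n+1` dilation). -/
noncomputable def Zb (n : ℕ) (cns s : ℝ) (z : Euc n) (lam : ℝ) (a : Fin (n + 1)) : Euc n → ℝ :=
  if h : (a : ℕ) < n then fun x => lam⁻¹ * dZBubble n cns s z lam ⟨a, h⟩ x
  else fun x => lam * dLamBubble n cns s z lam x

/-- A `δ`-interacting family of bubbles. -/
def DeltaInteracting (n : ℕ) {ν : ℕ} (z : Fin ν → Euc n) (lam : Fin ν → ℝ) (δ : ℝ) : Prop :=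
  (∀ i, 0 < lam i) ∧
    ∀ i j, i ≠ j →
      min (lam i / lam j)
        (min (lam j / lam i) (1 / (lam i * lam j * ‖z i - z j‖ ^ 2))) ≤ δ

/-- The pairwise interaction `q_{ij}`. -/
noncomputable def qij (n : ℕ) (s : ℝ) {ν : ℕ} (z : Fin ν → Euc n) (lam : Fin ν → ℝ)
    (i j : Fin ν) : ℝ :=
  (lam i / lam j + lam j / lam i + lam i * lam j * ‖z i - z j‖ ^ 2) ^
    (-(((n : ℝ) - 2 * s) / 2))

/-- `Q = max_{i ≠ j} q_{ij}`. -/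
noncomputable def Qmax (n : ℕ) (s : ℝ) {ν : ℕ} (z : Fin ν → Euc n) (lam : Fin ν → ℝ) : ℝ :=
  sSup {q : ℝ | ∃ i j, i ≠ j ∧ q = qij n s z lam i j}

noncomputable def Rij (n : ℕ) {ν : ℕ} (z : Fin ν → Euc n) (lam : Fin ν → ℝ) (i j : Fin ν) : ℝ :=
  max (Real.sqrt (lam i / lam j))
    (max (Real.sqrt (lam j / lam i)) (Real.sqrt (lam i * lam j) * ‖z i - z j‖))

/-- `R = (1/2) min_{i≠j} R_{ij}`. -/
noncomputable def Rmin (n : ℕ) {ν : ℕ} (z : Fin ν → Euc n) (lam : Fin ν → ℝ) : ℝ :=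
  (1 / 2) * sInf {r : ℝ | ∃ i j, i ≠ j ∧ r = Rij n z lam i j}

/-- Japanese bracket `⟨y⟩ = (1+|y|²)^{1/2}`. -/
noncomputable def jbr {n : ℕ} (y : Euc n) : ℝ := Real.sqrt (1 + ‖y‖ ^ 2)

/-- The weight function `V`. -/
noncomputable def Vwt (n : ℕ) (s : ℝ) {ν : ℕ} (z : Fin ν → Euc n) (lam : Fin ν → ℝ)
    (x : Euc n) : ℝ :=
  ∑ i, (lam i ^ (((n : ℝ) + 2 * s) / 2) * Rmin n z lam ^ (2 * s - (n : ℝ)) *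
          jbr (lam i • (x - z i)) ^ (-(4 * s)) *
          (if ‖lam i • (x - z i)‖ ≤ Rmin n z lam then (1 : ℝ) else 0) +
        lam i ^ (((n : ℝ) + 2 * s) / 2) * Rmin n z lam ^ (-(4 * s)) *
          jbr (lam i • (x - z i)) ^ (2 * s - (n : ℝ)) *
          (if Rmin n z lam / 2 ≤ ‖lam i • (x - z i)‖ then (1 : ℝ) else 0))

/-- The weight function `W`. -/
noncomputable def Wwt (n : ℕ) (s : ℝ) {ν : ℕ} (z : Fin ν → Euc n) (lam : Fin ν → ℝ)
    (x : Euc n) : ℝ :=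
  ∑ i, (lam i ^ (((n : ℝ) - 2 * s) / 2) * Rmin n z lam ^ (2 * s - (n : ℝ)) *
          jbr (lam i • (x - z i)) ^ (-(2 * s)) *
          (if ‖lam i • (x - z i)‖ ≤ Rmin n z lam then (1 : ℝ) else 0) +
        lam i ^ (((n : ℝ) - 2 * s) / 2) * Rmin n z lam ^ (-(4 * s)) *
          jbr (lam i • (x - z i)) ^ (4 * s - (n : ℝ)) *
          (if Rmin n z lam / 2 ≤ ‖lam i • (x - z i)‖ then (1 : ℝ) else 0))

/-- `‖φ‖_* = sup_x |φ(x)| W(x)⁻¹`. -/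
noncomputable def starNorm (n : ℕ) (s : ℝ) {ν : ℕ} (z : Fin ν → Euc n) (lam : Fin ν → ℝ)
    (φ : Euc n → ℝ) : ℝ :=
  ⨆ x : Euc n, |φ x| / Wwt n s z lam x

/-- `‖h‖_{**} = sup_x |h(x)| V(x)⁻¹`. -/
noncomputable def dstarNorm (n : ℕ) (s : ℝ) {ν : ℕ} (z : Fin ν → Euc n) (lam : Fin ν → ℝ)
    (h : Euc n → ℝ) : ℝ :=
  ⨆ x : Euc n, |h x| / Vwt n s z lam x

noncomputable def l2norm (n : ℕ) (f : Euc n → ℝ) : ℝ := Real.sqrt (∫ x, f x ^ 2)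

/-- The error function `(-Δ)^s u - u|u|^{p-1}`. -/
noncomputable def errFun (n : ℕ) (s : ℝ) (u : Euc n → ℝ) : Euc n → ℝ :=
  fun x => fracLap n s u x - u x * |u x| ^ (pexp n s - 1)

open Real Set

theorem lintegral_rpow_mul_exp_neg_div {q b : ℝ} (hq : 0 < q) (hb : 0 < b) :
    ∫⁻ θ in Ioi (0 : ℝ), ENNReal.ofReal (θ ^ (-q - 1) * exp (-(b / θ))) =
      ENNReal.ofReal (Gamma q * b ^ (-q)) := by
  have h1 : ∫ θ in Ioi (0 : ℝ), θ ^ (-q - 1) * exp (-(b / θ)) = Gamma q * b ^ (-q) := by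
    have h := integral_comp_rpow_Ioi (fun t : ℝ => t ^ (q - 1) * exp (-(b * t)))
      (show (-1 : ℝ) ≠ 0 by norm_num)
    rw [integral_rpow_mul_exp_neg_mul_Ioi hq hb, one_div, inv_rpow hb.le, ← rpow_neg hb.le] at h
    rw [mul_comm, ← h]
    refine setIntegral_congr_fun measurableSet_Ioi fun θ hθ => ?_
    have hθ : (0 : ℝ) < θ := hθ
    simp only [smul_eq_mul, abs_neg, abs_one, one_mul]
    rw [← mul_assoc, ← rpow_mul hθ.le, ← rpow_add hθ, rpow_neg_one, div_eq_mul_inv]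
    ring_nf
  rw [← ofReal_integral_eq_lintegral_ofReal, h1]
  · refine Integrable.of_integral_ne_zero ?_
    rw [h1]
    have := Gamma_pos_of_pos hq
    positivity
  · filter_upwards [ae_restrict_mem measurableSet_Ioi] with θ hθ
    have hθ : (0 : ℝ) < θ := hθ
    simp only [Pi.zero_apply]
    positivity

/-- The heat kernel on `ℝⁿ`, up to normalization of mass and of time. -/
def heat (n : ℕ) (θ : ℝ) (x : Euc n) : ℝ :=
  θ ^ (-((n : ℝ) / 2)) * exp (-(‖x‖ ^ 2 / θ))

theorem heat_nonneg (n : ℕ) {θ : ℝ} (hθ : 0 ≤ θ) (x : Euc n) : 0 ≤ heat n θ x := by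
  unfold heat; positivity

@[fun_prop]
theorem measurable_heat (n : ℕ) : Measurable (fun p : ℝ × Euc n => heat n p.1 p.2) := by
  unfold heat; fun_prop

theorem lintegral_exp_neg_mul_norm_sq (n : ℕ) {b : ℝ} (hb : 0 < b) :
    ∫⁻ y : Euc n, ENNReal.ofReal (exp (-(b * ‖y‖ ^ 2))) =
      ENNReal.ofReal ((π / b) ^ ((n : ℝ) / 2)) := by
  have h := GaussianFourier.integral_rexp_neg_mul_sq_norm (V := Euc n) hb
  rw [finrank_euclideanSpace, Fintype.card_fin] at h
  simp only [neg_mul] at h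
  rw [← h, ofReal_integral_eq_lintegral_ofReal]
  · refine Integrable.of_integral_ne_zero ?_
    rw [h]
    positivity
  · exact Filter.Eventually.of_forall fun y => (exp_pos _).le

theorem lintegral_heat (n : ℕ) {σ : ℝ} (hσ : 0 < σ) :
    ∫⁻ y : Euc n, ENNReal.ofReal (heat n σ y) = ENNReal.ofReal (π ^ ((n : ℝ) / 2)) := by
  have h := lintegral_exp_neg_mul_norm_sq n (inv_pos.2 hσ)
  simp only [heat, ENNReal.ofReal_mul (rpow_nonneg hσ.le _), div_eq_inv_mul]
  rw [lintegral_const_mul _ (by fun_prop)]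
  simp only [div_eq_inv_mul] at h
  rw [h, ← ENNReal.ofReal_mul (by positivity), inv_inv, mul_rpow hσ.le pi_pos.le, ← mul_assoc,
    ← rpow_add hσ]
  simp

theorem lintegral_heat_mul_heat (n : ℕ) {σ θ : ℝ} (hσ : 0 < σ) (hθ : 0 < θ) (x : Euc n) :
    ∫⁻ y : Euc n, ENNReal.ofReal (heat n σ y) * ENNReal.ofReal (heat n θ (x + y)) =
      ENNReal.ofReal (π ^ ((n : ℝ) / 2)) * ENNReal.ofReal (heat n (θ + σ) x) := by
  have hb : 0 < (θ + σ) / (σ * θ) := by positivity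
  have key : ∀ y : Euc n, heat n σ y * heat n θ (x + y) =
      (σ ^ (-((n : ℝ) / 2)) * θ ^ (-((n : ℝ) / 2)) * exp (-(‖x‖ ^ 2 / (θ + σ)))) *
        exp (-((θ + σ) / (σ * θ) * ‖y + (σ / (σ + θ)) • x‖ ^ 2)) := by
    intro y
    have e : ‖y‖ ^ 2 / σ + ‖x + y‖ ^ 2 / θ =
        ‖x‖ ^ 2 / (θ + σ) + (θ + σ) / (σ * θ) * ‖y + (σ / (σ + θ)) • x‖ ^ 2 := by
      rw [norm_add_sq_real, norm_add_sq_real, norm_smul, inner_smul_right, real_inner_comm x y,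
        Real.norm_of_nonneg (by positivity)]
      field_simp
      ring
    have e2 : exp (-(‖y‖ ^ 2 / σ)) * exp (-(‖x + y‖ ^ 2 / θ)) = exp (-(‖x‖ ^ 2 / (θ + σ))) *
        exp (-((θ + σ) / (σ * θ) * ‖y + (σ / (σ + θ)) • x‖ ^ 2)) := by
      rw [← exp_add, ← exp_add, ← neg_add, ← neg_add, e]
    unfold heat
    linear_combination (σ ^ (-((n : ℝ) / 2)) * θ ^ (-((n : ℝ) / 2))) * e2
  have hc : 0 ≤ σ ^ (-((n : ℝ) / 2)) * θ ^ (-((n : ℝ) / 2)) * exp (-(‖x‖ ^ 2 / (θ + σ))) := by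
    positivity
  simp only [← ENNReal.ofReal_mul (heat_nonneg n hσ.le _), key, ENNReal.ofReal_mul hc]
  rw [lintegral_const_mul _ (by fun_prop),
    lintegral_add_right_eq_self
      (fun y : Euc n => ENNReal.ofReal (exp (-((θ + σ) / (σ * θ) * ‖y‖ ^ 2)))),
    lintegral_exp_neg_mul_norm_sq n hb, ← ENNReal.ofReal_mul hc,
    ← ENNReal.ofReal_mul (by positivity)]
  congr 1
  unfold heat
  rw [div_div_eq_mul_div, div_rpow (by positivity) (by positivity), mul_rpow (by positivity)
    (by positivity), mul_rpow (by positivity) (by positivity), rpow_neg hσ.le, rpow_neg hθ.le,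
    rpow_neg (by positivity)]
  have h1 : 0 < σ ^ ((n : ℝ) / 2) := by positivity
  have h2 : 0 < θ ^ ((n : ℝ) / 2) := by positivity
  field_simp

/-- `θ^{s-1}` has vanishing Marchaud derivative of order `s`; this is its truncated form. -/
theorem lintegral_sub_rpow_mul_rpow_le {s ε θ : ℝ} (hs0 : 0 < s) (hε : 0 < ε) (h : ε < θ) :
    ∫⁻ σ in Ioo ε θ, ENNReal.ofReal (θ ^ s * ((θ - σ) ^ (s - 1) * σ ^ (-1 - s))) ≤
      ENNReal.ofReal (θ ^ (2 * s - 1) * (ε ^ (-s) / s)) := by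
  have hθ : 0 < θ := hε.trans h
  set G : ℝ → ℝ := fun σ => -(θ ^ s * ((s * θ)⁻¹ * ((θ - σ) ^ s * σ ^ (-s)))) with hG
  have hder : ∀ σ ∈ Ioo ε θ,
      HasDerivAt G (θ ^ s * ((θ - σ) ^ (s - 1) * σ ^ (-1 - s))) σ := by
    intro σ hσ
    have h1 : 0 < θ - σ := sub_pos.2 hσ.2
    have h2 : 0 < σ := hε.trans hσ.1
    have d1 : HasDerivAt (fun σ => (θ - σ) ^ s) (-1 * s * (θ - σ) ^ (s - 1)) σ :=
      ((hasDerivAt_id σ).const_sub θ).rpow_const (Or.inl h1.ne')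
    have d2 : HasDerivAt (fun σ : ℝ => σ ^ (-s)) (-s * σ ^ (-s - 1)) σ :=
      hasDerivAt_rpow_const (Or.inl h2.ne')
    refine (((d1.mul d2).const_mul ((s * θ)⁻¹)).const_mul (θ ^ s)).neg.congr_deriv ?_
    have e1 : (θ - σ) ^ s = (θ - σ) ^ (s - 1) * (θ - σ) := by
      rw [← rpow_add_one h1.ne']; ring_nf
    have e2 : σ ^ (-s) = σ ^ (-1 - s) * σ := by
      rw [← rpow_add_one h2.ne']; ring_nf
    rw [e1, e2, show -s - 1 = -1 - s by ring]
    field_simp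
    ring
  have hpos : ∀ σ ∈ Ioo ε θ, 0 ≤ θ ^ s * ((θ - σ) ^ (s - 1) * σ ^ (-1 - s)) := by
    intro σ hσ
    have h1 : 0 < θ - σ := sub_pos.2 hσ.2
    have h2 : 0 < σ := hε.trans hσ.1
    positivity
  have hcont : ContinuousOn G (Icc ε θ) := by
    intro σ hσ
    have h2 : 0 < σ := hε.trans_le hσ.1
    refine ContinuousAt.continuousWithinAt ?_
    refine ContinuousAt.neg (continuousAt_const.mul (continuousAt_const.mul (ContinuousAt.mul ?_ ?_)))
    · exact (continuousAt_const.sub continuousAt_id).rpow_const (Or.inr hs0.le)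
    · exact continuousAt_id.rpow_const (Or.inl h2.ne')
  have hint := intervalIntegral.integrableOn_deriv_of_nonneg hcont hder hpos
  have hval := intervalIntegral.integral_eq_sub_of_hasDerivAt_of_le h.le hcont hder
    ((intervalIntegrable_iff_integrableOn_Ioc_of_le h.le).2 hint)
  rw [intervalIntegral.integral_of_le h.le, integral_Ioc_eq_integral_Ioo] at hval
  rw [← ofReal_integral_eq_lintegral_ofReal (hint.mono_set Ioo_subset_Ioc_self)
    ((ae_restrict_iff' measurableSet_Ioo).2 (Filter.Eventually.of_forall hpos)), hval]
  refine ENNReal.ofReal_le_ofReal ?_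
  simp only [hG, sub_self, zero_rpow hs0.ne']
  have e : (θ - ε) ^ s ≤ θ ^ s := rpow_le_rpow (sub_pos.2 h).le (by linarith) hs0.le
  have e3 : θ ^ (2 * s - 1) = θ ^ s * (θ⁻¹ * θ ^ s) := by
    rw [← rpow_neg_one, ← rpow_add hθ, ← rpow_add hθ]; ring_nf
  rw [e3]
  have : θ ^ s * ((s * θ)⁻¹ * ((θ - ε) ^ s * ε ^ (-s))) ≤
      θ ^ s * ((s * θ)⁻¹ * (θ ^ s * ε ^ (-s))) := by gcongr
  refine le_trans (by linarith) (this.trans_eq ?_)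
  field_simp

theorem sub_rpow_mul_rpow_add_le {s σ θ : ℝ} (hs0 : 0 < s) (hs1 : s < 1) (hσ : 0 < σ)
    (h : σ < θ) :
    (θ - σ) ^ (2 * s - 1) * σ ^ (-1 - s) + s * θ ^ (s - 2) ≤
      θ ^ s * ((θ - σ) ^ (s - 1) * σ ^ (-1 - s)) := by
  have hθ : 0 < θ := hσ.trans h
  have h1 : 0 < θ - σ := sub_pos.2 h
  have b : (θ - σ) ^ s ≤ θ ^ s - s * σ * θ ^ (s - 1) := by
    have := rpow_one_add_le_one_add_mul_self (s := -(σ / θ)) (p := s)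
      (by rw [neg_le_neg_iff, div_le_one hθ]; exact h.le) hs0.le hs1.le
    have h3 : θ - σ = θ * (1 + -(σ / θ)) := by field_simp; ring
    have h4 : 0 ≤ 1 + -(σ / θ) := by
      have : σ / θ ≤ 1 := by rw [div_le_one hθ]; exact h.le
      linarith
    rw [h3, mul_rpow hθ.le h4, rpow_sub_one hθ.ne']
    calc _ ≤ θ ^ s * (1 + s * -(σ / θ)) := by gcongr
      _ = _ := by field_simp; ring
  have e1 : (θ - σ) ^ (2 * s - 1) = (θ - σ) ^ (s - 1) * (θ - σ) ^ s := by
    rw [← rpow_add h1]; ring_nf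
  have m1 : θ ^ (s - 1) ≤ (θ - σ) ^ (s - 1) :=
    rpow_le_rpow_of_nonpos h1 (by linarith) (by linarith)
  have m2 : θ ^ (-s) ≤ σ ^ (-s) := rpow_le_rpow_of_nonpos hσ h.le (by linarith)
  have e2 : σ ^ (-s) = σ ^ (-1 - s) * σ := by
    rw [← rpow_add_one hσ.ne']; ring_nf
  have e4 : θ ^ (s - 2) = θ ^ (s - 1) * (θ ^ (s - 1) * θ ^ (-s)) := by
    rw [← rpow_add hθ, ← rpow_add hθ]; ring_nf
  calc (θ - σ) ^ (2 * s - 1) * σ ^ (-1 - s) + s * θ ^ (s - 2)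
      ≤ (θ - σ) ^ (s - 1) * (θ ^ s - s * σ * θ ^ (s - 1)) * σ ^ (-1 - s) +
        s * ((θ - σ) ^ (s - 1) * (θ ^ (s - 1) * σ ^ (-s))) := by
        rw [e1, e4]; gcongr
    _ = _ := by rw [e2]; ring

theorem lintegral_Ioo_marchaud_le {s ε θ : ℝ} (hs0 : 0 < s) (hs1 : s < 1) (hε : 0 < ε)
    (h : ε < θ) :
    (∫⁻ σ in Ioo ε θ, ENNReal.ofReal ((θ - σ) ^ (2 * s - 1) * σ ^ (-1 - s))) +
        ENNReal.ofReal (s * θ ^ (s - 2) * (θ - ε)) ≤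
      ENNReal.ofReal (θ ^ (2 * s - 1) * (ε ^ (-s) / s)) := by
  have hθ : 0 < θ := by linarith
  refine le_trans ?_ (lintegral_sub_rpow_mul_rpow_le hs0 hε h)
  have h2 : ENNReal.ofReal (s * θ ^ (s - 2) * (θ - ε)) =
      ∫⁻ σ in Ioo ε θ, ENNReal.ofReal (s * θ ^ (s - 2)) := by
    rw [setLIntegral_const, Real.volume_Ioo, ← ENNReal.ofReal_mul (by positivity)]
  rw [h2, ← lintegral_add_right _ measurable_const]
  refine setLIntegral_mono' measurableSet_Ioo fun σ hσ => ?_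
  have h1 : 0 < θ - σ := sub_pos.2 hσ.2
  have h3 : 0 < σ := hε.trans hσ.1
  rw [← ENNReal.ofReal_add (by positivity) (by positivity)]
  exact ENNReal.ofReal_le_ofReal (sub_rpow_mul_rpow_add_le hs0 hs1 h3 hσ.2)

theorem lintegral_Ioo_marchaud_mul_exp_le {s ε θ : ℝ} (hs0 : 0 < s) (hs1 : s < 1) (hε : 0 < ε)
    (hθ : 0 < θ) :
    (∫⁻ σ in Ioo ε θ, ENNReal.ofReal (σ ^ (-1 - s)) *
        ENNReal.ofReal ((θ - σ) ^ (2 * s - 1) * exp (-(1 / (θ - σ))))) +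
        (Ioi (2 * ε)).indicator
          (fun θ => ENNReal.ofReal (s / 2 * (θ ^ (s - 1) * exp (-(1 / θ))))) θ ≤
      ENNReal.ofReal (ε ^ (-s) / s) * ENNReal.ofReal (θ ^ (2 * s - 1) * exp (-(1 / θ))) := by
  rcases le_or_gt θ ε with h | h
  · rw [Ioo_eq_empty (not_lt.2 h), indicator_of_notMem (by simp only [mem_Ioi]; linarith)]
    simp
  have h1 : ∫⁻ σ in Ioo ε θ, ENNReal.ofReal (σ ^ (-1 - s)) *
        ENNReal.ofReal ((θ - σ) ^ (2 * s - 1) * exp (-(1 / (θ - σ)))) ≤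
      ENNReal.ofReal (exp (-(1 / θ))) *
        ∫⁻ σ in Ioo ε θ, ENNReal.ofReal ((θ - σ) ^ (2 * s - 1) * σ ^ (-1 - s)) := by
    rw [← lintegral_const_mul _ (by fun_prop)]
    refine setLIntegral_mono' measurableSet_Ioo fun σ hσ => ?_
    have h1 : 0 < θ - σ := sub_pos.2 hσ.2
    have h3 : 0 < σ := hε.trans hσ.1
    rw [← ENNReal.ofReal_mul (by positivity), ← ENNReal.ofReal_mul (by positivity)]
    refine ENNReal.ofReal_le_ofReal ?_
    have : exp (-(1 / (θ - σ))) ≤ exp (-(1 / θ)) := by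
      rw [exp_le_exp, neg_le_neg_iff]
      exact one_div_le_one_div_of_le h1 (by linarith)
    calc _ ≤ σ ^ (-1 - s) * ((θ - σ) ^ (2 * s - 1) * exp (-(1 / θ))) := by gcongr
      _ = _ := by ring
  have h2 : (Ioi (2 * ε)).indicator
        (fun θ => ENNReal.ofReal (s / 2 * (θ ^ (s - 1) * exp (-(1 / θ))))) θ ≤
      ENNReal.ofReal (exp (-(1 / θ))) * ENNReal.ofReal (s * θ ^ (s - 2) * (θ - ε)) := by
    refine indicator_apply_le' (fun h2 => ?_) fun _ => bot_le
    have h2 : 2 * ε < θ := h2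
    rw [← ENNReal.ofReal_mul (by positivity)]
    refine ENNReal.ofReal_le_ofReal ?_
    have e : θ ^ (s - 1) = θ ^ (s - 2) * θ := by rw [← rpow_add_one hθ.ne']; ring_nf
    rw [e]
    have : 0 < exp (-(1 / θ)) * (s * θ ^ (s - 2)) := by positivity
    nlinarith
  calc _ ≤ _ := add_le_add h1 h2
    _ ≤ ENNReal.ofReal (exp (-(1 / θ))) * ENNReal.ofReal (θ ^ (2 * s - 1) * (ε ^ (-s) / s)) := by
      rw [← mul_add]
      exact mul_le_mul_right (lintegral_Ioo_marchaud_le hs0 hs1 hε h) _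
    _ = _ := by
      have := rpow_pos_of_pos hε (-s)
      rw [← ENNReal.ofReal_mul (by positivity), ← ENNReal.ofReal_mul (by positivity)]
      ring_nf

theorem setLIntegral_Ioi_mul_add (Φ H : ℝ → ENNReal) (σ : ℝ) :
    ∫⁻ θ in Ioi (0 : ℝ), Φ θ * H (θ + σ) =
      ∫⁻ θ, (Ioi σ).indicator (fun θ => Φ (θ - σ) * H θ) θ := by
  rw [← lintegral_indicator measurableSet_Ioi,
    ← lintegral_add_right_eq_self ((Ioi σ).indicator fun θ => Φ (θ - σ) * H θ) σ]
  refine lintegral_congr fun θ => ?_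
  simp [indicator]

theorem lintegral_Ioi_mul_lintegral_shift (ψ Φ H : ℝ → ENNReal) (hψ : Measurable ψ)
    (hΦ : Measurable Φ) (hH : Measurable H) {ε : ℝ} (hε : 0 < ε) :
    ∫⁻ σ in Ioi ε, ψ σ * ∫⁻ θ in Ioi (0 : ℝ), Φ θ * H (θ + σ) =
      ∫⁻ θ in Ioi (0 : ℝ), (∫⁻ σ in Ioo ε θ, ψ σ * Φ (θ - σ)) * H θ := by
  set S : Set (ℝ × ℝ) := {p | ε < p.1 ∧ p.1 < p.2} with hS
  have hSm : MeasurableSet S :=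
    (measurableSet_lt measurable_const measurable_fst).inter
      (measurableSet_lt measurable_fst measurable_snd)
  have hfm : Measurable (S.indicator fun p => ψ p.1 * Φ (p.2 - p.1) * H p.2) :=
    Measurable.indicator (by fun_prop) hSm
  calc _ = ∫⁻ σ, ∫⁻ θ, S.indicator (fun p => ψ p.1 * Φ (p.2 - p.1) * H p.2) (σ, θ) := by
        rw [← lintegral_indicator measurableSet_Ioi]
        refine lintegral_congr fun σ => ?_
        by_cases hσ : ε < σ
        · rw [indicator_of_mem (show σ ∈ Ioi ε from hσ), setLIntegral_Ioi_mul_add,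
            ← lintegral_const_mul _ (Measurable.indicator (by fun_prop) measurableSet_Ioi)]
          refine lintegral_congr fun θ => ?_
          by_cases hθ : σ < θ <;> simp [indicator, hS, hσ, hθ, mul_assoc]
        · rw [indicator_of_notMem (by simpa using hσ)]
          simp [indicator, hS, hσ]
    _ = ∫⁻ θ, ∫⁻ σ, S.indicator (fun p => ψ p.1 * Φ (p.2 - p.1) * H p.2) (σ, θ) :=
        lintegral_lintegral_swap hfm.aemeasurable
    _ = _ := by
        rw [← lintegral_indicator measurableSet_Ioi]
        refine lintegral_congr fun θ => ?_
        by_cases hθ : 0 < θ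
        · rw [indicator_of_mem (show θ ∈ Ioi (0 : ℝ) from hθ),
            ← lintegral_mul_const _ (by fun_prop), ← lintegral_indicator measurableSet_Ioo]
          refine lintegral_congr fun σ => ?_
          by_cases h : ε < σ ∧ σ < θ <;> simp [indicator, hS, h]
        · rw [indicator_of_notMem (by simpa using hθ)]
          have : ∀ σ, ¬ (ε < σ ∧ σ < θ) := fun σ h => hθ (hε.trans (h.1.trans h.2))
          simp [indicator, hS, this]

theorem lintegral_marchaud_le {s ε : ℝ} (hs0 : 0 < s) (hs1 : s < 1) (hε : 0 < ε)
    (H : ℝ → ENNReal) (hH : Measurable H) :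
    (∫⁻ σ in Ioi ε, ENNReal.ofReal (σ ^ (-1 - s)) *
        ∫⁻ θ in Ioi (0 : ℝ), ENNReal.ofReal (θ ^ (2 * s - 1) * exp (-(1 / θ))) * H (θ + σ)) +
        ∫⁻ θ in Ioi (2 * ε), ENNReal.ofReal (s / 2 * (θ ^ (s - 1) * exp (-(1 / θ)))) * H θ ≤
      ENNReal.ofReal (ε ^ (-s) / s) *
        ∫⁻ θ in Ioi (0 : ℝ), ENNReal.ofReal (θ ^ (2 * s - 1) * exp (-(1 / θ))) * H θ := by
  rw [lintegral_Ioi_mul_lintegral_shift (fun σ => ENNReal.ofReal (σ ^ (-1 - s)))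
    (fun θ => ENNReal.ofReal (θ ^ (2 * s - 1) * exp (-(1 / θ)))) H (by fun_prop) (by fun_prop)
    hH hε, ← lintegral_const_mul _ (by fun_prop)]
  have e : ∫⁻ θ in Ioi (2 * ε), ENNReal.ofReal (s / 2 * (θ ^ (s - 1) * exp (-(1 / θ)))) * H θ =
      ∫⁻ θ in Ioi (0 : ℝ), (Ioi (2 * ε)).indicator
        (fun θ => ENNReal.ofReal (s / 2 * (θ ^ (s - 1) * exp (-(1 / θ))))) θ * H θ := by
    rw [← lintegral_indicator measurableSet_Ioi, ← lintegral_indicator measurableSet_Ioi]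
    refine lintegral_congr fun θ => ?_
    by_cases h : 2 * ε < θ
    · have h0 : 0 < θ := by linarith
      simp [indicator, h, h0]
    · simp [indicator, h]
  have hm : Measurable fun θ => (Ioi (2 * ε)).indicator
      (fun θ => ENNReal.ofReal (s / 2 * (θ ^ (s - 1) * exp (-(1 / θ))))) θ * H θ :=
    (Measurable.indicator (by fun_prop) measurableSet_Ioi).mul hH
  rw [e, ← lintegral_add_right _ hm]
  refine setLIntegral_mono' measurableSet_Ioi fun θ hθ => ?_
  rw [← add_mul, ← mul_assoc]
  exact mul_le_mul_left (lintegral_Ioo_marchaud_mul_exp_le hs0 hs1 hε hθ) _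

/-- The fundamental integral representing powers of `1 + |x|²` by heat kernels. -/
theorem lintegral_mul_heat (n : ℕ) {q : ℝ} (hq : 0 < q) (x : Euc n) :
    ∫⁻ θ in Ioi (0 : ℝ), ENNReal.ofReal (θ ^ ((n : ℝ) / 2 - q - 1) * exp (-(1 / θ))) *
        ENNReal.ofReal (heat n θ x) =
      ENNReal.ofReal (Gamma q * (1 + ‖x‖ ^ 2) ^ (-q)) := by
  rw [← lintegral_rpow_mul_exp_neg_div hq (by positivity)]
  refine setLIntegral_congr_fun measurableSet_Ioi fun θ hθ => ?_
  have hθ : (0 : ℝ) < θ := hθ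
  simp only [heat]
  rw [← ENNReal.ofReal_mul (by positivity), mul_mul_mul_comm, ← exp_add, ← rpow_add hθ]
  congr 3 <;> ring

/-- The kernel of the fractional Laplacian as a superposition of heat kernels. -/
theorem lintegral_rpow_mul_heat (n : ℕ) {s : ℝ} (hs : 0 < s) {y : Euc n} (hy : y ≠ 0) :
    ∫⁻ σ in Ioi (0 : ℝ), ENNReal.ofReal (σ ^ (-1 - s)) * ENNReal.ofReal (heat n σ y) =
      ENNReal.ofReal (Gamma ((n : ℝ) / 2 + s) / ‖y‖ ^ ((n : ℝ) + 2 * s)) := by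
  have hy : 0 < ‖y‖ := norm_pos_iff.2 hy
  have e : Gamma ((n : ℝ) / 2 + s) / ‖y‖ ^ ((n : ℝ) + 2 * s) =
      Gamma ((n : ℝ) / 2 + s) * (‖y‖ ^ 2) ^ (-((n : ℝ) / 2 + s)) := by
    rw [← rpow_natCast, ← rpow_mul hy.le, div_eq_mul_inv, ← rpow_neg hy.le]
    congr 2
    push_cast
    ring
  rw [e, ← lintegral_rpow_mul_exp_neg_div (by positivity) (by positivity)]
  refine setLIntegral_congr_fun measurableSet_Ioi fun θ hθ => ?_
  have hθ : (0 : ℝ) < θ := hθ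
  simp only [heat]
  rw [← ENNReal.ofReal_mul (by positivity), ← mul_assoc, ← rpow_add hθ]
  congr 3
  ring

theorem lintegral_heat_mul_rpow (n : ℕ) {s : ℝ} (hn : 4 * s < n) {σ : ℝ} (hσ : 0 < σ)
    (x : Euc n) :
    ∫⁻ y : Euc n, ENNReal.ofReal (heat n σ y) * ENNReal.ofReal
        (Gamma ((n : ℝ) / 2 - 2 * s) * (1 + ‖x + y‖ ^ 2) ^ (-((n : ℝ) / 2 - 2 * s))) =
      ENNReal.ofReal (π ^ ((n : ℝ) / 2)) * ∫⁻ θ in Ioi (0 : ℝ),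
        ENNReal.ofReal (θ ^ (2 * s - 1) * exp (-(1 / θ))) * ENNReal.ofReal (heat n (θ + σ) x) := by
  have ha : 0 < (n : ℝ) / 2 - 2 * s := by linarith
  simp only [← lintegral_mul_heat n ha, sub_sub_cancel]
  have hm : Measurable fun p : Euc n × ℝ => ENNReal.ofReal (heat n σ p.1) *
      (ENNReal.ofReal (p.2 ^ (2 * s - 1) * exp (-(1 / p.2))) *
        ENNReal.ofReal (heat n p.2 (x + p.1))) := by
    unfold heat; fun_prop
  have hm' : ∀ θ : ℝ, Measurable fun y : Euc n => ENNReal.ofReal (heat n σ y) *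
        ENNReal.ofReal (heat n θ (x + y)) := by
    unfold heat; fun_prop
  have hm2 : ∀ y : Euc n, Measurable fun θ : ℝ =>
      ENNReal.ofReal (θ ^ (2 * s - 1) * exp (-(1 / θ))) * ENNReal.ofReal (heat n θ (x + y)) := by
    unfold heat; fun_prop
  have hm3 : Measurable fun θ : ℝ => ENNReal.ofReal (θ ^ (2 * s - 1) * exp (-(1 / θ))) *
      ENNReal.ofReal (heat n (θ + σ) x) := by
    unfold heat; fun_prop
  simp only [← lintegral_const_mul _ (hm2 _)]
  rw [lintegral_lintegral_swap hm.aemeasurable, ← lintegral_const_mul _ hm3]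
  refine setLIntegral_congr_fun measurableSet_Ioi fun θ hθ => ?_
  have hθ : (0 : ℝ) < θ := hθ
  simp only [mul_left_comm (ENNReal.ofReal (heat n σ _))]
  rw [lintegral_const_mul _ (hm' θ), lintegral_heat_mul_heat n hσ hθ, mul_left_comm]

theorem lintegral_heat_average_rpow_le (n : ℕ) {s : ℝ} (hs0 : 0 < s) (hs1 : s < 1)
    (hn : 4 * s < n) {ε : ℝ} (hε : 0 < ε) (x : Euc n) :
    (∫⁻ σ in Ioi ε, ENNReal.ofReal (σ ^ (-1 - s)) *
        ∫⁻ y : Euc n, ENNReal.ofReal (heat n σ y) * ENNReal.ofReal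
          (Gamma ((n : ℝ) / 2 - 2 * s) * (1 + ‖x + y‖ ^ 2) ^ (-((n : ℝ) / 2 - 2 * s)))) +
        ∫⁻ θ in Ioi (2 * ε), ENNReal.ofReal (π ^ ((n : ℝ) / 2)) *
          (ENNReal.ofReal (s / 2 * (θ ^ (s - 1) * exp (-(1 / θ)))) *
            ENNReal.ofReal (heat n θ x)) ≤
      ENNReal.ofReal (π ^ ((n : ℝ) / 2)) * (ENNReal.ofReal (ε ^ (-s) / s) * ENNReal.ofReal
        (Gamma ((n : ℝ) / 2 - 2 * s) * (1 + ‖x‖ ^ 2) ^ (-((n : ℝ) / 2 - 2 * s)))) := by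
  have ha : 0 < (n : ℝ) / 2 - 2 * s := by linarith
  have hm : Measurable fun p : ℝ × ℝ => ENNReal.ofReal (p.2 ^ (2 * s - 1) * exp (-(1 / p.2))) *
      ENNReal.ofReal (heat n (p.2 + p.1) x) := by
    unfold heat; fun_prop
  have hm1 : Measurable fun σ : ℝ => ENNReal.ofReal (σ ^ (-1 - s)) *
      ∫⁻ θ in Ioi (0 : ℝ), ENNReal.ofReal (θ ^ (2 * s - 1) * exp (-(1 / θ))) *
        ENNReal.ofReal (heat n (θ + σ) x) :=
    Measurable.mul (by fun_prop) hm.lintegral_prod_right'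
  have hm2 : Measurable fun θ : ℝ => ENNReal.ofReal (s / 2 * (θ ^ (s - 1) * exp (-(1 / θ)))) *
      ENNReal.ofReal (heat n θ x) := by
    unfold heat; fun_prop
  have hH : Measurable fun θ : ℝ => ENNReal.ofReal (heat n θ x) := by
    unfold heat; fun_prop
  have e : ∫⁻ σ in Ioi ε, ENNReal.ofReal (σ ^ (-1 - s)) *
        ∫⁻ y : Euc n, ENNReal.ofReal (heat n σ y) * ENNReal.ofReal
          (Gamma ((n : ℝ) / 2 - 2 * s) * (1 + ‖x + y‖ ^ 2) ^ (-((n : ℝ) / 2 - 2 * s))) =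
      ∫⁻ σ in Ioi ε, ENNReal.ofReal (π ^ ((n : ℝ) / 2)) * (ENNReal.ofReal (σ ^ (-1 - s)) *
        ∫⁻ θ in Ioi (0 : ℝ), ENNReal.ofReal (θ ^ (2 * s - 1) * exp (-(1 / θ))) *
          ENNReal.ofReal (heat n (θ + σ) x)) := by
    refine setLIntegral_congr_fun measurableSet_Ioi fun σ hσ => ?_
    rw [lintegral_heat_mul_rpow n hn (hε.trans hσ), mul_left_comm]
  rw [e, lintegral_const_mul _ hm1, lintegral_const_mul _ hm2, ← mul_add,
    ← lintegral_mul_heat n ha, sub_sub_cancel]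
  exact mul_le_mul_right (lintegral_marchaud_le hs0 hs1 hε _ hH) _

theorem setLIntegral_Ioi_zero_le {f : ℝ → ENNReal} {C : ENNReal}
    (h : ∀ δ > 0, ∫⁻ σ in Ioi δ, f σ ≤ C) : ∫⁻ σ in Ioi (0 : ℝ), f σ ≤ C := by
  have hU : Ioi (0 : ℝ) = ⋃ m : ℕ, Ioi (1 / ((m : ℝ) + 1)) := by
    ext t
    simp only [mem_Ioi, mem_iUnion]
    exact ⟨exists_nat_one_div_lt, fun ⟨m, hm⟩ => lt_trans (by positivity) hm⟩
  rw [hU, setLIntegral_iUnion_of_directed]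
  · exact iSup_le fun m => h _ (by positivity)
  · refine Monotone.directed_le fun i j hij => Ioi_subset_Ioi ?_
    gcongr

theorem two_mul_ofReal (r : ℝ) : 2 * ENNReal.ofReal r = ENNReal.ofReal (2 * r) := by
  rw [ENNReal.ofReal_mul (by norm_num), ENNReal.ofReal_ofNat]

theorem lintegral_heat_mul_second_difference (n : ℕ) {σ : ℝ} (hσ : 0 < σ) {v : Euc n → ℝ}
    (hv : Measurable v) (hv0 : ∀ y, 0 ≤ v y) (x : Euc n) :
    (∫⁻ y, ENNReal.ofReal (heat n σ y) *
        ENNReal.ofReal (-(2 * v x - v (x + y) - v (x - y)))) +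
        2 * (ENNReal.ofReal (π ^ ((n : ℝ) / 2)) * ENNReal.ofReal (v x)) =
      (∫⁻ y, ENNReal.ofReal (heat n σ y) *
        ENNReal.ofReal (2 * v x - v (x + y) - v (x - y))) +
        2 * ∫⁻ y, ENNReal.ofReal (heat n σ y) * ENNReal.ofReal (v (x + y)) := by
  have hmK : Measurable fun y => ENNReal.ofReal (heat n σ y) := by unfold heat; fun_prop
  have e : ∫⁻ y, ENNReal.ofReal (heat n σ y) * ENNReal.ofReal (v (x + y)) =
      ∫⁻ y, ENNReal.ofReal (heat n σ y) * ENNReal.ofReal (v (x - y)) := by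
    rw [← lintegral_neg_eq_self]
    simp [heat, sub_eq_add_neg]
  have e2 : 2 * ∫⁻ y, ENNReal.ofReal (heat n σ y) * ENNReal.ofReal (v (x + y)) =
      (∫⁻ y, ENNReal.ofReal (heat n σ y) * ENNReal.ofReal (v (x + y))) +
        ∫⁻ y, ENNReal.ofReal (heat n σ y) * ENNReal.ofReal (v (x - y)) := by
    rw [two_mul, ← e]
  rw [e2, ← lintegral_heat n hσ, ← lintegral_mul_const _ hmK, ← lintegral_const_mul _ (by fun_prop),
    ← lintegral_add_right _ (by fun_prop), ← lintegral_add_right _ (by fun_prop),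
    ← lintegral_add_right _ (by fun_prop)]
  refine lintegral_congr fun y => ?_
  rw [mul_left_comm 2, ← mul_add, ← mul_add, ← mul_add]
  congr 1
  have h1 := hv0 x
  have h2 := hv0 (x + y)
  have h3 := hv0 (x - y)
  rw [← ENNReal.ofReal_add h2 h3, two_mul_ofReal]
  rcases le_total 0 (2 * v x - v (x + y) - v (x - y)) with h | h
  · rw [ENNReal.ofReal_of_nonpos (neg_nonpos.2 h), zero_add, ← ENNReal.ofReal_add h (by positivity)]
    ring_nf
  · rw [ENNReal.ofReal_of_nonpos h, zero_add,
      ← ENNReal.ofReal_add (neg_nonneg.2 h) (by positivity)]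
    ring_nf

theorem setLIntegral_Ioi_rpow {s ε : ℝ} (hs : 0 < s) (hε : 0 < ε) :
    ∫⁻ σ in Ioi ε, ENNReal.ofReal (σ ^ (-1 - s)) = ENNReal.ofReal (ε ^ (-s) / s) := by
  have h := integral_Ioi_rpow_of_lt (show -1 - s < -1 by linarith) hε
  rw [← ofReal_integral_eq_lintegral_ofReal
    (integrableOn_Ioi_rpow_of_lt (show -1 - s < -1 by linarith) hε), h]
  · rw [show -1 - s + 1 = -s by ring, neg_div_neg_eq]
  · filter_upwards [ae_restrict_mem measurableSet_Ioi] with σ hσ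
    exact rpow_nonneg (hε.trans hσ).le _

theorem lintegral_neg_part_add_le (n : ℕ) {s : ℝ} (hs : 0 < s) {v : Euc n → ℝ}
    (hv : Measurable v) (hv0 : ∀ y, 0 ≤ v y) (x : Euc n) {g : ℝ → ENNReal} (hg : Measurable g)
    (h : ∀ ε > 0, (∫⁻ σ in Ioi ε, ENNReal.ofReal (σ ^ (-1 - s)) *
        ∫⁻ y, ENNReal.ofReal (heat n σ y) * ENNReal.ofReal (v (x + y))) +
        ∫⁻ θ in Ioi (2 * ε), g θ ≤
      ENNReal.ofReal (π ^ ((n : ℝ) / 2)) *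
        (ENNReal.ofReal (ε ^ (-s) / s) * ENNReal.ofReal (v x))) :
    (∫⁻ y, ENNReal.ofReal (-(2 * v x - v (x + y) - v (x - y))) *
        ∫⁻ σ in Ioi (0 : ℝ), ENNReal.ofReal (σ ^ (-1 - s)) * ENNReal.ofReal (heat n σ y)) +
        2 * ∫⁻ θ in Ioi (0 : ℝ), g θ ≤
      ∫⁻ y, ENNReal.ofReal (2 * v x - v (x + y) - v (x - y)) *
        ∫⁻ σ in Ioi (0 : ℝ), ENNReal.ofReal (σ ^ (-1 - s)) * ENNReal.ofReal (heat n σ y) := by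
  have swap : ∀ w : Euc n → ENNReal, Measurable w →
      ∫⁻ y, w y * ∫⁻ σ in Ioi (0 : ℝ), ENNReal.ofReal (σ ^ (-1 - s)) *
          ENNReal.ofReal (heat n σ y) =
        ∫⁻ σ in Ioi (0 : ℝ), ENNReal.ofReal (σ ^ (-1 - s)) *
          ∫⁻ y, ENNReal.ofReal (heat n σ y) * w y := by
    intro w hw
    have h1 : ∀ y : Euc n, Measurable fun σ : ℝ =>
        ENNReal.ofReal (σ ^ (-1 - s)) * ENNReal.ofReal (heat n σ y) := by
      unfold heat; fun_prop
    have h2 : ∀ σ : ℝ, Measurable fun y : Euc n => ENNReal.ofReal (heat n σ y) * w y := by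
      unfold heat; fun_prop
    simp only [← lintegral_const_mul _ (h1 _), ← lintegral_const_mul _ (h2 _)]
    rw [lintegral_lintegral_swap]
    · exact lintegral_congr fun σ => lintegral_congr fun y => by ring
    · refine Measurable.aemeasurable ?_
      unfold heat; fun_prop
  have hmeas : ∀ w : Euc n → ENNReal, Measurable w → Measurable fun σ : ℝ =>
      ENNReal.ofReal (σ ^ (-1 - s)) * ∫⁻ y, ENNReal.ofReal (heat n σ y) * w y := by
    intro w hw
    refine Measurable.mul (by fun_prop) (Measurable.lintegral_prod_right'
      (f := fun p : ℝ × Euc n => ENNReal.ofReal (heat n p.1 p.2) * w p.2) ?_)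
    fun_prop
  have hm1 := hmeas (fun y => ENNReal.ofReal (-(2 * v x - v (x + y) - v (x - y)))) (by fun_prop)
  have hm2 := hmeas (fun y => ENNReal.ofReal (2 * v x - v (x + y) - v (x - y))) (by fun_prop)
  have hm3 := hmeas (fun y => ENNReal.ofReal (v (x + y))) (by fun_prop)
  rw [swap _ (by fun_prop), swap _ (by fun_prop), ← lintegral_const_mul _ hg,
    ← lintegral_add_left hm1]
  refine setLIntegral_Ioi_zero_le fun δ hδ => ?_
  rw [lintegral_add_left hm1, lintegral_const_mul _ hg]
  have hε : 0 < δ / 2 := by positivity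
  specialize h (δ / 2) hε
  rw [mul_div_cancel₀ δ two_ne_zero] at h
  set ε := δ / 2 with hεd
  have hid : (∫⁻ σ in Ioi ε, ENNReal.ofReal (σ ^ (-1 - s)) *
        ∫⁻ y, ENNReal.ofReal (heat n σ y) *
          ENNReal.ofReal (-(2 * v x - v (x + y) - v (x - y)))) +
        2 * (ENNReal.ofReal (π ^ ((n : ℝ) / 2)) *
          (ENNReal.ofReal (ε ^ (-s) / s) * ENNReal.ofReal (v x))) =
      (∫⁻ σ in Ioi ε, ENNReal.ofReal (σ ^ (-1 - s)) *
        ∫⁻ y, ENNReal.ofReal (heat n σ y) *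
          ENNReal.ofReal (2 * v x - v (x + y) - v (x - y))) +
        2 * ∫⁻ σ in Ioi ε, ENNReal.ofReal (σ ^ (-1 - s)) *
          ∫⁻ y, ENNReal.ofReal (heat n σ y) * ENNReal.ofReal (v (x + y)) := by
    have e1 : 2 * (ENNReal.ofReal (π ^ ((n : ℝ) / 2)) *
          (ENNReal.ofReal (ε ^ (-s) / s) * ENNReal.ofReal (v x))) =
        ∫⁻ σ in Ioi ε, ENNReal.ofReal (σ ^ (-1 - s)) *
          (2 * (ENNReal.ofReal (π ^ ((n : ℝ) / 2)) * ENNReal.ofReal (v x))) := by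
      rw [lintegral_mul_const _ (by fun_prop), setLIntegral_Ioi_rpow hs hε]
      ring
    rw [e1, ← lintegral_const_mul _ hm3, ← lintegral_add_left hm1, ← lintegral_add_left hm2]
    refine setLIntegral_congr_fun measurableSet_Ioi fun σ hσ => ?_
    rw [← mul_add, lintegral_heat_mul_second_difference n (hε.trans hσ) hv hv0, mul_add,
      mul_left_comm 2]
  refine ENNReal.le_of_add_le_add_right (a := 2 * (ENNReal.ofReal (π ^ ((n : ℝ) / 2)) *
          (ENNReal.ofReal (ε ^ (-s) / s) * ENNReal.ofReal (v x)))) ?_ ?_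
  · exact ENNReal.mul_ne_top (by simp) (ENNReal.mul_ne_top ENNReal.ofReal_ne_top
      (ENNReal.mul_ne_top ENNReal.ofReal_ne_top ENNReal.ofReal_ne_top))
  · have hsub : Ioi δ ⊆ Ioi ε := Ioi_subset_Ioi (by linarith)
    have hsub0 : Ioi ε ⊆ Ioi 0 := Ioi_subset_Ioi hε.le
    rw [add_right_comm]
    calc _ ≤ _ := add_le_add_left (add_le_add_left (lintegral_mono_set hsub) _) _
      _ = _ := by rw [hid, add_assoc, ← mul_add]
      _ ≤ _ := add_le_add (lintegral_mono_set hsub0) (mul_le_mul_right h _)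

theorem rpow_neg_sub_le {a p q : ℝ} (hp : 0 < p) (hq : 0 < q) (ha : 0 ≤ a) :
    q ^ (-a) - a * (q ^ (-a) / q) * (p - q) ≤ p ^ (-a) := by
  have hr : 0 < p / q := by positivity
  have h1 : 1 - a * (p / q - 1) ≤ (p / q) ^ (-a) := by
    rw [rpow_def_of_pos hr]
    have h2 := add_one_le_exp (log (p / q) * -a)
    have h3 := mul_le_mul_of_nonneg_left (log_le_sub_one_of_pos hr) ha
    linarith
  have h4 : p ^ (-a) = q ^ (-a) * (p / q) ^ (-a) := by
    rw [← mul_rpow hq.le hr.le, mul_div_cancel₀ p hq.ne']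
  rw [h4]
  calc _ = q ^ (-a) * (1 - a * (p / q - 1)) := by field_simp
    _ ≤ _ := by gcongr

theorem second_difference_rpow_le (n : ℕ) {a : ℝ} (ha : 0 ≤ a) (x y : Euc n) :
    2 * (1 + ‖x‖ ^ 2) ^ (-a) - (1 + ‖x + y‖ ^ 2) ^ (-a) - (1 + ‖x - y‖ ^ 2) ^ (-a) ≤
      (2 * a + 2) * min 1 (‖y‖ ^ 2) := by
  have hx : 1 ≤ 1 + ‖x‖ ^ 2 := by linarith [sq_nonneg ‖x‖]
  have hu : (1 + ‖x‖ ^ 2) ^ (-a) ≤ 1 := rpow_le_one_of_one_le_of_nonpos hx (by linarith)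
  have hu0 : 0 < (1 + ‖x‖ ^ 2) ^ (-a) := by positivity
  rcases le_total 1 (‖y‖ ^ 2) with h | h
  · rw [min_eq_left h]
    have h1 : 0 < (1 + ‖x + y‖ ^ 2) ^ (-a) := by positivity
    have h2 : 0 < (1 + ‖x - y‖ ^ 2) ^ (-a) := by positivity
    linarith
  · rw [min_eq_right h]
    have h1 := rpow_neg_sub_le (p := 1 + ‖x + y‖ ^ 2) (q := 1 + ‖x‖ ^ 2) (by positivity)
      (by positivity) ha
    have h2 := rpow_neg_sub_le (p := 1 + ‖x - y‖ ^ 2) (q := 1 + ‖x‖ ^ 2) (by positivity)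
      (by positivity) ha
    have h3 : (1 + ‖x‖ ^ 2) ^ (-a) / (1 + ‖x‖ ^ 2) ≤ 1 :=
      (div_le_self hu0.le hx).trans hu
    have h4 : a * ((1 + ‖x‖ ^ 2) ^ (-a) / (1 + ‖x‖ ^ 2)) * (2 * ‖y‖ ^ 2) ≤
        a * 1 * (2 * ‖y‖ ^ 2) := by gcongr
    rw [norm_add_sq_real] at h1 ⊢
    rw [norm_sub_sq_real] at h2 ⊢
    nlinarith [sq_nonneg ‖y‖]

theorem integrable_min_one_sq_div_rpow (n : ℕ) (hn : 0 < n) {s : ℝ} (hs0 : 0 < s) (hs1 : s < 1) :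
    Integrable fun y : Euc n => min 1 (‖y‖ ^ 2) / ‖y‖ ^ ((n : ℝ) + 2 * s) := by
  have : NeZero n := ⟨hn.ne'⟩
  have hm : ∀ t : ℝ, 0 < t → t ^ (n - 1) = t ^ ((n : ℝ) - 1) := by
    intro t ht
    rw [← rpow_natCast, Nat.cast_sub hn, Nat.cast_one]
  rw [integrable_fun_norm_addHaar volume
    (f := fun r : ℝ => min 1 (r ^ 2) / r ^ ((n : ℝ) + 2 * s)), finrank_euclideanSpace,
    Fintype.card_fin, ← Ioc_union_Ioi_eq_Ioi (zero_le_one' ℝ), integrableOn_union]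
  constructor
  · have h : IntegrableOn (fun t : ℝ => t ^ (1 - 2 * s)) (Ioc 0 1) :=
      (intervalIntegrable_iff_integrableOn_Ioc_of_le zero_le_one).1
        (intervalIntegral.intervalIntegrable_rpow' (by linarith))
    refine h.congr_fun (fun t ht => ?_) measurableSet_Ioc
    have h0 : 0 < t := ht.1
    have h1 : t ^ 2 ≤ 1 := pow_le_one₀ h0.le ht.2
    simp only [smul_eq_mul, min_eq_right h1]
    rw [hm t h0, ← rpow_natCast, div_eq_mul_inv, ← rpow_neg h0.le, ← rpow_add h0, ← rpow_add h0]
    congr 1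
    push_cast
    ring
  · have h : IntegrableOn (fun t : ℝ => t ^ (-1 - 2 * s)) (Ioi 1) :=
      integrableOn_Ioi_rpow_of_lt (by linarith) one_pos
    refine h.congr_fun (fun t ht => ?_) measurableSet_Ioi
    have ht : 1 < t := ht
    have h0 : 0 < t := by linarith
    have h1 : 1 ≤ t ^ 2 := one_le_pow₀ ht.le
    simp only [smul_eq_mul, min_eq_left h1]
    rw [hm t h0, one_div, ← rpow_neg h0.le, ← rpow_add h0]
    congr 1
    ring

theorem le_integral_of_lintegral_neg_add_le {α : Type*} [MeasurableSpace α] {μ : Measure α}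
    {f : α → ℝ} (hf : Measurable f) {c : ℝ}
    (hfin : ∫⁻ y, ENNReal.ofReal (f y) ∂μ ≠ ⊤)
    (h : (∫⁻ y, ENNReal.ofReal (-f y) ∂μ) + ENNReal.ofReal c ≤ ∫⁻ y, ENNReal.ofReal (f y) ∂μ) :
    c ≤ ∫ y, f y ∂μ := by
  have hneg : ∫⁻ y, ENNReal.ofReal (-f y) ∂μ ≠ ⊤ :=
    ne_top_of_le_ne_top hfin (le_self_add.trans h)
  have hint : Integrable f μ := by
    refine ⟨hf.aestronglyMeasurable, ?_⟩
    rw [hasFiniteIntegral_iff_norm]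
    have : ∀ y, ENNReal.ofReal ‖f y‖ = ENNReal.ofReal (f y) + ENNReal.ofReal (-f y) := by
      intro y
      rcases le_total 0 (f y) with h | h
      · rw [ENNReal.ofReal_of_nonpos (neg_nonpos.2 h), add_zero, Real.norm_of_nonneg h]
      · rw [ENNReal.ofReal_of_nonpos h, zero_add, Real.norm_of_nonpos h]
    simp only [this]
    rw [lintegral_add_left (by fun_prop)]
    exact ENNReal.add_lt_top.2 ⟨hfin.lt_top, hneg.lt_top⟩
  rw [integral_eq_lintegral_pos_part_sub_lintegral_neg_part hint]
  have h1 := ENNReal.toReal_mono hfin h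
  rw [ENNReal.toReal_add hneg ENNReal.ofReal_ne_top] at h1
  have h2 : c ≤ (ENNReal.ofReal c).toReal := by
    rw [ENNReal.toReal_ofReal']; exact le_max_left _ _
  linarith

theorem fracC_pos (n : ℕ) {s : ℝ} (hs0 : 0 < s) (hs1 : s < 1) : 0 < fracC n s := by
  have h1 : 0 < Gamma (((n : ℝ) + 2 * s) / 2) := Gamma_pos_of_pos (by positivity)
  have h2 : Gamma (-s) ≠ 0 := by
    refine Gamma_ne_zero fun m hm => ?_
    have hm' : s = m := by linarith
    rcases Nat.eq_zero_or_pos m with rfl | h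
    · simp at hm'; linarith
    · have : (1 : ℝ) ≤ m := by exact_mod_cast h
      linarith
  have h3 : 0 < |Gamma (-s)| := abs_pos.2 h2
  unfold fracC
  positivity

theorem le_integral_second_difference (n : ℕ) {s : ℝ} (hs0 : 0 < s) (hs1 : s < 1)
    (hn : 4 * s < (n : ℝ)) (x : Euc n) :
    π ^ ((n : ℝ) / 2) * s * Gamma ((n : ℝ) / 2 - s) * (1 + ‖x‖ ^ 2) ^ (-((n : ℝ) / 2 - s)) ≤
      Gamma ((n : ℝ) / 2 + s) * Gamma ((n : ℝ) / 2 - 2 * s) *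
        ∫ y : Euc n, (2 * (1 + ‖x‖ ^ 2) ^ (-((n : ℝ) / 2 - 2 * s)) -
            (1 + ‖x + y‖ ^ 2) ^ (-((n : ℝ) / 2 - 2 * s)) -
            (1 + ‖x - y‖ ^ 2) ^ (-((n : ℝ) / 2 - 2 * s))) / ‖y‖ ^ ((n : ℝ) + 2 * s) := by
  have ha : 0 < (n : ℝ) / 2 - 2 * s := by linarith
  have hb : 0 < (n : ℝ) / 2 - s := by linarith
  have hn0 : 0 < n := by
    have : (0 : ℝ) < n := by linarith
    exact_mod_cast this
  have hA := Gamma_pos_of_pos ha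
  have hB := Gamma_pos_of_pos hb
  have hC : 0 < Gamma ((n : ℝ) / 2 + s) := Gamma_pos_of_pos (by positivity)
  set a := (n : ℝ) / 2 - 2 * s with had
  set v : Euc n → ℝ := fun y => Gamma a * (1 + ‖y‖ ^ 2) ^ (-a) with hv
  have hvm : Measurable v := by fun_prop
  set f : Euc n → ℝ := fun y => (2 * v x - v (x + y) - v (x - y)) *
    (Gamma ((n : ℝ) / 2 + s) / ‖y‖ ^ ((n : ℝ) + 2 * s)) with hf
  have hfm : Measurable f := by fun_prop
  have hint : Gamma ((n : ℝ) / 2 + s) * Gamma a *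
        ∫ y : Euc n, (2 * (1 + ‖x‖ ^ 2) ^ (-a) - (1 + ‖x + y‖ ^ 2) ^ (-a) -
            (1 + ‖x - y‖ ^ 2) ^ (-a)) / ‖y‖ ^ ((n : ℝ) + 2 * s) = ∫ y, f y := by
    rw [← integral_const_mul]
    congr 1
    ext y
    simp only [hf, hv]
    ring
  rw [hint]
  have hmul : ∀ w : Euc n → ℝ, w 0 ≤ 0 → ∀ y, ENNReal.ofReal (w y) *
      ∫⁻ σ in Ioi (0 : ℝ), ENNReal.ofReal (σ ^ (-1 - s)) * ENNReal.ofReal (heat n σ y) =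
      ENNReal.ofReal (w y * (Gamma ((n : ℝ) / 2 + s) / ‖y‖ ^ ((n : ℝ) + 2 * s))) := by
    intro w hw y
    rcases eq_or_ne y 0 with rfl | hy
    · rw [ENNReal.ofReal_of_nonpos hw, zero_mul, norm_zero, zero_rpow (by positivity)]
      simp
    · rw [lintegral_rpow_mul_heat n hs0 hy, ← ENNReal.ofReal_mul' (by positivity)]
  refine le_integral_of_lintegral_neg_add_le hfm ?_ ?_
  · have hI := ((integrable_min_one_sq_div_rpow n hn0 hs0 hs1).const_mul
      (Gamma a * (2 * a + 2) * Gamma ((n : ℝ) / 2 + s))).lintegral_lt_top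
    refine ne_top_of_le_ne_top hI.ne (lintegral_mono fun y => ENNReal.ofReal_le_ofReal ?_)
    have h1 : 2 * v x - v (x + y) - v (x - y) ≤ Gamma a * ((2 * a + 2) * min 1 (‖y‖ ^ 2)) := by
      have := mul_le_mul_of_nonneg_left (second_difference_rpow_le n ha.le x y) hA.le
      simp only [hv]
      linarith
    calc f y ≤ Gamma a * ((2 * a + 2) * min 1 (‖y‖ ^ 2)) *
          (Gamma ((n : ℝ) / 2 + s) / ‖y‖ ^ ((n : ℝ) + 2 * s)) := by
          simp only [hf]; gcongr
      _ = _ := by ring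
  · have hgm : Measurable fun θ : ℝ => ENNReal.ofReal (s / 2 * (θ ^ (s - 1) * exp (-(1 / θ)))) *
        ENNReal.ofReal (heat n θ x) := by
      unfold heat; fun_prop
    have key := lintegral_neg_part_add_le n hs0 hvm (fun y => by simp only [hv]; positivity) x
      (hgm.const_mul (ENNReal.ofReal (π ^ ((n : ℝ) / 2))))
      (fun ε hε => lintegral_heat_average_rpow_le n hs0 hs1 hn hε x)
    simp only [hmul (fun y => -(2 * v x - v (x + y) - v (x - y))) (by simp; linarith),
      hmul (fun y => 2 * v x - v (x + y) - v (x - y)) (by simp; linarith), neg_mul] at key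
    refine le_trans (le_of_eq ?_) key
    congr 1
    have hm0 : Measurable fun θ : ℝ => ENNReal.ofReal (θ ^ (s - 1) * exp (-(1 / θ))) *
        ENNReal.ofReal (heat n θ x) := by
      unfold heat; fun_prop
    have h1 := lintegral_mul_heat n hb x
    rw [sub_sub_cancel] at h1
    simp only [ENNReal.ofReal_mul (show 0 ≤ s / 2 by positivity), mul_assoc]
    rw [lintegral_const_mul _ (hm0.const_mul _), lintegral_const_mul _ hm0, h1,
      ← ENNReal.ofReal_mul (by positivity), ← ENNReal.ofReal_mul (by positivity),
      two_mul_ofReal]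
    congr 1
    ring

/-- For `s ∈ (0,1)` and `n > 4s` there is `α_{n,s} > 0` with
`(-Δ)^s (1+|·|²)^{(4s-n)/2} (x) ≥ α_{n,s} (1+|x|²)^{(2s-n)/2}` for all `x ∈ ℝⁿ`. -/
theorem stmt_18 (n : ℕ) (s : ℝ) (hs0 : 0 < s) (hs1 : s < 1) (hn : 4 * s < (n : ℝ)) :
    ∃ α : ℝ, 0 < α ∧ ∀ x : Euc n,
      α * (1 + ‖x‖ ^ 2) ^ ((2 * s - (n : ℝ)) / 2) ≤
        fracLap n s (fun y => (1 + ‖y‖ ^ 2) ^ ((4 * s - (n : ℝ)) / 2)) x := by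
  have hA : 0 < Real.Gamma ((n : ℝ) / 2 - 2 * s) := Real.Gamma_pos_of_pos (by linarith)
  have hB : 0 < Real.Gamma ((n : ℝ) / 2 - s) := Real.Gamma_pos_of_pos (by linarith)
  have hC : 0 < Real.Gamma ((n : ℝ) / 2 + s) := Real.Gamma_pos_of_pos (by positivity)
  have hF := fracC_pos n hs0 hs1
  refine ⟨fracC n s / 2 * (Real.pi ^ ((n : ℝ) / 2) * s * Real.Gamma ((n : ℝ) / 2 - s) /
    (Real.Gamma ((n : ℝ) / 2 + s) * Real.Gamma ((n : ℝ) / 2 - 2 * s))), by positivity,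
    fun x => ?_⟩
  have key := le_integral_second_difference n hs0 hs1 hn x
  have e1 : (2 * s - (n : ℝ)) / 2 = -((n : ℝ) / 2 - s) := by ring
  have e2 : (4 * s - (n : ℝ)) / 2 = -((n : ℝ) / 2 - 2 * s) := by ring
  unfold fracLap
  rw [e1, e2, mul_assoc]
  refine mul_le_mul_of_nonneg_left ?_ (by positivity)
  rw [div_mul_eq_mul_div, div_le_iff₀ (by positivity)]
  exact key.trans_eq (mul_comm _ _)
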